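/- Let x = (x_1, …, x_n) ∈ [0,1]^n and x' = (x'_1, …, x'_n) ∈ [0,1]^n be two agent location profiles, and let y* be a Nash optimum for x and y'* a Nash optimum for x'. Then |y* − y'*| ≤ max_{1 ≤ i ≤ n} |x_i − x'_i|. -/

import Mathlib

open Set

noncomputable section

/-- Utility of an agent at location `z` when the facility is at `y`. -/
def util (y z : ℝ) : ℝ := 1 - |y - z|

/-- Nash welfare: product of agents' utilities. -/
def nash {n : ℕ} (y : ℝ) (x : Fin n → ℝ) : ℝ := ∏ i, util y (x i)

/-- `y` is a Nash optimum for the profile `x`. -/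
def isNashOpt {n : ℕ} (x : Fin n → ℝ) (y : ℝ) : Prop :=
  y ∈ Set.Icc (0 : ℝ) 1 ∧ ∀ z ∈ Set.Icc (0 : ℝ) 1, nash z x ≤ nash y x

theorem util_nonneg {y z : ℝ} (hy : y ∈ Set.Icc (0 : ℝ) 1) (hz : z ∈ Set.Icc (0 : ℝ) 1) :
    0 ≤ util y z :=
  sub_nonneg.2 (abs_le.2 ⟨by linarith [hy.1, hz.2], by linarith [hy.2, hz.1]⟩)

theorem isNashOpt.util_pos {n : ℕ} {x : Fin n → ℝ} {y : ℝ} (hy : isNashOpt x y)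
    (hx : ∀ i, x i ∈ Set.Icc (0 : ℝ) 1) (i : Fin n) : 0 < util y (x i) := by
  have half_pos : 0 < nash (1 / 2) x := Finset.prod_pos fun j _ =>
    sub_pos.2 (abs_lt.2 ⟨by linarith [(hx j).2], by linarith [(hx j).1]⟩)
  have pos : 0 < nash y x := half_pos.trans_le (hy.2 _ ⟨by norm_num, by norm_num⟩)
  exact (util_nonneg hy.1 (hx i)).lt_of_ne'
    (Finset.prod_ne_zero_iff.1 pos.ne' i (Finset.mem_univ i))

/-- Strict log-concavity of `w ↦ 1 - |w|`: moving two points towards each other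
increases the product of their values. -/
theorem mul_one_sub_abs_lt {v w t : ℝ} (ht : 0 < t) (hvw : 2 * t ≤ w - v)
    (hv : 0 < 1 - |v|) (hw : 0 < 1 - |w|) :
    (1 - |v|) * (1 - |w|) < (1 - |v + t|) * (1 - |w - t|) := by
  rcases abs_cases v with ⟨h1, h1'⟩ | ⟨h1, h1'⟩ <;>
  rcases abs_cases w with ⟨h2, h2'⟩ | ⟨h2, h2'⟩ <;>
  rcases abs_cases (v + t) with ⟨h3, h3'⟩ | ⟨h3, h3'⟩ <;>
  rcases abs_cases (w - t) with ⟨h4, h4'⟩ | ⟨h4, h4'⟩ <;>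
  rw [h1] at hv ⊢ <;> rw [h2] at hw ⊢ <;> rw [h3, h4] <;>
  first
  | linarith
  | nlinarith [mul_pos ht ht, mul_pos ht hv, mul_pos ht hw, mul_pos hv hw]

theorem isNashOpt.sub_le {n : ℕ} (hn : 0 < n) {x x' : Fin n → ℝ}
    (hx : ∀ i, x i ∈ Set.Icc (0 : ℝ) 1) (hx' : ∀ i, x' i ∈ Set.Icc (0 : ℝ) 1)
    {y y' d : ℝ} (hy : isNashOpt x y) (hy' : isNashOpt x' y')
    (hd : ∀ i, |x i - x' i| ≤ d) : y' - y ≤ d := by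
  by_contra! h
  have : Nonempty (Fin n) := ⟨⟨0, hn⟩⟩
  have d_nonneg : 0 ≤ d := (abs_nonneg _).trans (hd ⟨0, hn⟩)
  obtain ⟨t, ht⟩ : ∃ t, t = (y' - y - d) / 2 := ⟨_, rfl⟩
  have t_pos : 0 < t := by linarith
  have mem : y + t ∈ Set.Icc (0 : ℝ) 1 :=
    ⟨by linarith [hy.1.1], by linarith [hy'.1.2]⟩
  have mem' : y' - t ∈ Set.Icc (0 : ℝ) 1 :=
    ⟨by linarith [hy.1.1], by linarith [hy'.1.2]⟩
  have lt : nash y x * nash y' x' < nash (y + t) x * nash (y' - t) x' := by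
    simp only [nash, ← Finset.prod_mul_distrib]
    refine Finset.prod_lt_prod_of_nonempty
      (fun i _ => mul_pos (hy.util_pos hx i) (hy'.util_pos hx' i)) (fun i _ => ?_)
      Finset.univ_nonempty
    have key := mul_one_sub_abs_lt t_pos
      (by linarith [(abs_le.1 (hd i)).1] : 2 * t ≤ (y' - x' i) - (y - x i))
      (hy.util_pos hx i) (hy'.util_pos hx' i)
    rwa [sub_add_eq_add_sub, sub_right_comm] at key
  exact lt.not_ge (mul_le_mul (hy.2 _ mem) (hy'.2 _ mem')
    (Finset.prod_nonneg fun i _ => util_nonneg mem' (hx' i))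
    (Finset.prod_nonneg fun i _ => util_nonneg hy.1 (hx i)))

theorem nashFL_lipschitz (n : ℕ) (hn : 0 < n) (x x' : Fin n → ℝ)
    (hx : ∀ i, x i ∈ Set.Icc (0 : ℝ) 1) (hx' : ∀ i, x' i ∈ Set.Icc (0 : ℝ) 1)
    (ystar ystar' : ℝ)
    (hy : isNashOpt x ystar) (hy' : isNashOpt x' ystar') :
    |ystar - ystar'| ≤
      Finset.univ.sup' ⟨⟨0, hn⟩, Finset.mem_univ _⟩ (fun i => |x i - x' i|) := by
  have hd : ∀ i, |x i - x' i| ≤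
      Finset.univ.sup' ⟨⟨0, hn⟩, Finset.mem_univ _⟩ (fun i => |x i - x' i|) :=
    fun i => Finset.le_sup' (fun i => |x i - x' i|) (Finset.mem_univ i)
  exact abs_sub_le_iff.2
    ⟨hy'.sub_le hn hx' hx hy fun i => abs_sub_comm (x i) (x' i) ▸ hd i,
      hy.sub_le hn hx hx' hy' hd⟩
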